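/- Let d, n ≥ 1 and let M be a linear operator on (ℂ^d)^{⊗n}. Then M commutes with P_d(π) for every π ∈ S_n if and only if M lies in the complex linear span of {X^{⊗n} : X a d×d complex matrix}. -/

import Mathlib

open Matrix

noncomputable section

/-- The operator `P_d(π)` on `(ℂ^d)^{⊗n}` permuting tensor factors. -/
def permMat (d n : ℕ) (π : Equiv.Perm (Fin n)) :
    Matrix (Fin n → Fin d) (Fin n → Fin d) ℂ :=
  fun a b => if ∀ t, a t = b (π⁻¹ t) then 1 else 0

/-- The `n`-fold tensor power `X^{⊗n}` of a `d×d` matrix `X`. -/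
def matTensorPow (d n : ℕ) (X : Matrix (Fin d) (Fin d) ℂ) :
    Matrix (Fin n → Fin d) (Fin n → Fin d) ℂ :=
  fun a b => ∏ t, X (a t) (b t)

theorem mul_permMat_apply {d n : ℕ} (M : Matrix (Fin n → Fin d) (Fin n → Fin d) ℂ)
    (π : Equiv.Perm (Fin n)) (a b : Fin n → Fin d) :
    (M * permMat d n π) a b = M a (b ∘ ⇑π⁻¹) := by
  have h (c : Fin n → Fin d) : (∀ t, c t = b (π⁻¹ t)) ↔ c = b ∘ ⇑π⁻¹ := by
    simp [funext_iff]
  simp only [Matrix.mul_apply, permMat, h]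
  simp

theorem permMat_mul_apply {d n : ℕ} (M : Matrix (Fin n → Fin d) (Fin n → Fin d) ℂ)
    (π : Equiv.Perm (Fin n)) (a b : Fin n → Fin d) :
    (permMat d n π * M) a b = M (a ∘ ⇑π) b := by
  have h (c : Fin n → Fin d) : (∀ t, a t = c (π⁻¹ t)) ↔ a ∘ ⇑π = c := by
    rw [funext_iff, ← π.forall_congr_right]
    simp
  simp only [Matrix.mul_apply, permMat, h]
  simp

theorem commutes_permMat_iff {d n : ℕ} (M : Matrix (Fin n → Fin d) (Fin n → Fin d) ℂ)
    (π : Equiv.Perm (Fin n)) :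
    M * permMat d n π = permMat d n π * M ↔ ∀ a b, M (a ∘ ⇑π) (b ∘ ⇑π) = M a b := by
  simp only [← Matrix.ext_iff, mul_permMat_apply, permMat_mul_apply]
  refine forall_congr' fun a => ⟨fun h b => ?_, fun h b => ?_⟩
  · simpa [Function.comp_def] using (h (b ∘ ⇑π)).symm
  · simpa [Function.comp_def] using (h (b ∘ ⇑π⁻¹)).symm

theorem matTensorPow_comp_perm {d n : ℕ} (X : Matrix (Fin d) (Fin d) ℂ)
    (π : Equiv.Perm (Fin n)) (a b : Fin n → Fin d) :
    matTensorPow d n X (a ∘ ⇑π) (b ∘ ⇑π) = matTensorPow d n X a b :=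
  Equiv.prod_comp π fun t => X (a t) (b t)

/-- If `∑ u, c u * ∏ t, x (u t)` vanishes identically, then `c` is orthogonal to every
permutation-invariant function. -/
theorem sum_mul_eq_zero_of_perm_invariant {R ι σ : Type*} [CommRing R] [IsDomain R] [Infinite R]
    [Fintype ι] [DecidableEq ι] [Fintype σ] (c f : (ι → σ) → R)
    (hc : ∀ x : σ → R, ∑ u, c u * ∏ t, x (u t) = 0)
    (hf : ∀ (π : Equiv.Perm ι) u, f (u ∘ ⇑π) = f u) : ∑ u, f u * c u = 0 := by
  classical
  let e : (ι → σ) → σ →₀ ℕ := fun u => ∑ t, Finsupp.single (u t) 1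
  have hp : ∑ u, MvPolynomial.monomial (e u) (c u) = 0 := by
    refine MvPolynomial.funext fun x => ?_
    rw [map_zero, ← hc x, map_sum]
    refine Finset.sum_congr rfl fun u _ => ?_
    simp [e, MvPolynomial.monomial_sum_index, MvPolynomial.eval_monomial]
  have he (u v : ι → σ) (h : e u = e v) : f u = f v := by
    have hcard (s : σ) : Fintype.card {t // u t = s} = Fintype.card {t // v t = s} := by
      simpa [e, Finsupp.single_apply, Fintype.card_subtype] using DFunLike.congr_fun h s
    let π : Equiv.Perm ι := Equiv.ofFiberEquiv fun s => Fintype.equivOfCardEq (hcard s)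
    have hπ : v ∘ ⇑π = u := funext fun t => Equiv.ofFiberEquiv_map _ t
    rw [← hπ, hf]
  rw [← Finset.sum_fiberwise_of_maps_to (t := Finset.univ.image e) (g := e) (by simp)]
  refine Finset.sum_eq_zero fun m hm => ?_
  obtain ⟨v, -, rfl⟩ := Finset.mem_image.1 hm
  have h0 := congrArg (MvPolynomial.coeff (e v)) hp
  simp only [MvPolynomial.coeff_sum, MvPolynomial.coeff_monomial, MvPolynomial.coeff_zero,
    ← Finset.sum_filter] at h0
  rw [Finset.sum_congr rfl fun u hu => by rw [he u v (Finset.mem_filter.1 hu).2],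
    ← Finset.mul_sum, h0, mul_zero]

/-- `M` commutes with every permutation operator `P_d(π)` iff `M` lies in the complex
linear span of the tensor powers `X^{⊗n}`. -/
theorem commutes_with_perms_iff_mem_span_tensor_powers
    (d n : ℕ) (hd : 1 ≤ d) (hn : 1 ≤ n)
    (M : Matrix (Fin n → Fin d) (Fin n → Fin d) ℂ) :
    (∀ π : Equiv.Perm (Fin n), M * permMat d n π = permMat d n π * M) ↔
      M ∈ Submodule.span ℂ
        {N : Matrix (Fin n → Fin d) (Fin n → Fin d) ℂ |
          ∃ X : Matrix (Fin d) (Fin d) ℂ, N = matTensorPow d n X} := by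
  constructor
  · intro h
    simp only [commutes_permMat_iff] at h
    by_contra hM
    obtain ⟨φ, hφM, hφ⟩ := Submodule.exists_le_ker_of_notMem hM
    refine hφM ?_
    have hsum (N : Matrix (Fin n → Fin d) (Fin n → Fin d) ℂ) :
        φ N = ∑ u : Fin n → Fin d × Fin d, N (fun t => (u t).1) (fun t => (u t).2) *
          φ (Matrix.single (fun t => (u t).1) (fun t => (u t).2) 1) := by
      conv_lhs => rw [Matrix.matrix_eq_sum_single N]
      rw [← (Equiv.arrowProdEquivProdArrow (Fin n) (fun _ => Fin d) (fun _ => Fin d)).symm.sum_comp,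
        Fintype.sum_prod_type]
      simp only [map_sum]
      refine Finset.sum_congr rfl fun a _ => Finset.sum_congr rfl fun b _ => ?_
      rw [← smul_eq_mul, ← map_smul, Matrix.smul_single, smul_eq_mul, mul_one]
      rfl
    rw [hsum]
    refine sum_mul_eq_zero_of_perm_invariant _
      (fun u : Fin n → Fin d × Fin d => M (fun t => (u t).1) (fun t => (u t).2)) (fun x => ?_) fun π u =>
        h π (fun t => (u t).1) (fun t => (u t).2)
    have hx : φ (matTensorPow d n (Matrix.of fun i j => x (i, j))) = 0 :=
      hφ (Submodule.subset_span ⟨_, rfl⟩)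
    rw [← hx, hsum]
    exact Finset.sum_congr rfl fun u _ => mul_comm _ _
  · intro h π
    induction h using Submodule.span_induction with
    | mem N hN =>
      obtain ⟨X, rfl⟩ := hN
      exact (commutes_permMat_iff _ π).2 (matTensorPow_comp_perm X π)
    | zero => simp
    | add A B _ _ hA hB => rw [add_mul, mul_add, hA, hB]
    | smul c A _ hA => rw [smul_mul_assoc, mul_smul_comm, hA]
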